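/- arXiv:1111.6633 — 6 statements merged into one kernel-verified Lean document; each statement's English description precedes it below -/
import Mathlib

section
/- In the counterexample market with parameter n, there exists n₀ ∈ ℕ such that for every n ≥ n₀ the following holds: for every spread-valued adapted process S̃ one has J(S̃) > J (and in fact J < ∞). In particular, no spread-valued adapted process is a shadow price, i.e. there is no adapted process S̃ with S̲_t ≤ S̃_t ≤ S̄_t a.s. for t = 0,1,2 satisfying J(S̃) = J. -/
open MeasureTheory ENNReal Filter

noncomputable section

/-- Sample space of the counterexample market: first coordinate `k ∈ ℕ`,
second coordinate the Bernoulli outcome at time 2 (`true` = ask price jumps up). -/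
abbrev Omega : Type := ℕ × Bool

/-- `q n k = 2^{-(n+k)}` as an extended nonnegative real. -/
def q (n k : ℕ) : ℝ≥0∞ := (2 : ℝ≥0∞)⁻¹ ^ (n + k)

/-- The first-coordinate probabilities: `p 0 = 1 - 2^{-n}`, `p k = 2^{-(n+k)}` for `k ≥ 1`. -/
def pk (n : ℕ) (k : ℕ) : ℝ≥0∞ := if k = 0 then 1 - (2 : ℝ≥0∞)⁻¹ ^ n else (2 : ℝ≥0∞)⁻¹ ^ (n + k)

/-- The weight of each atom `(k, j)` of the counterexample market. -/
def w (n : ℕ) : Omega → ℝ≥0∞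
  | (k, true) => pk n k * q n k
  | (k, false) => pk n k * (1 - q n k)

/-- The probability measure of the counterexample market with parameter `n`. -/
def P (n : ℕ) : Measure Omega := Measure.sum (fun ω => w n ω • Measure.dirac ω)

/-- Ask price of the risky asset at time 1 in the state with first coordinate `k`. -/
def ask1 (k : ℕ) : ℝ := 2 + k

/-- Ask price of the risky asset at time 2. -/
def ask2 : Omega → ℝ
  | (k, true) => 3 + k
  | (_, false) => 1

/-- A (trading) strategy, given by holdings in the safe asset (`a`) and the risky asset (`b`)
at times `0,1,2`; adaptedness to the filtration (trivial at time 0, generated by the first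
coordinate at time 1, everything at time 2) is encoded by the arguments of the functions. -/
structure Strat where
  a0 : ℝ
  b0 : ℝ
  a1 : ℕ → ℝ
  b1 : ℕ → ℝ
  a2 : Omega → ℝ
  b2 : Omega → ℝ

/-- Self-financing condition with transaction costs, from pre-trade initial position
`(x0, y0)`: purchases are made at the ask price, sales at the bid price. -/
def SelfFinancingTC (x0 y0 : ℝ) (φ : Strat) : Prop :=
  (φ.a0 - x0 ≤ -(max (φ.b0 - y0) 0) * 3 + max (y0 - φ.b0) 0 * 3) ∧
  (∀ k : ℕ, φ.a1 k - φ.a0 ≤ -(max (φ.b1 k - φ.b0) 0) * ask1 k + max (φ.b0 - φ.b1 k) 0 * 2) ∧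
  (∀ ω : Omega,
    φ.a2 ω - φ.a1 ω.1 ≤ -(max (φ.b2 ω - φ.b1 ω.1) 0) * ask2 ω + max (φ.b1 ω.1 - φ.b2 ω) 0 * 1)

/-- An adapted (to the filtration of the counterexample market) real-valued price process. -/
structure PriceProc where
  s0 : ℝ
  s1 : ℕ → ℝ
  s2 : Omega → ℝ

/-- A price process valued in the bid-ask spread `[S̲, S̄]`. -/
def SpreadValued (S : PriceProc) : Prop :=
  S.s0 = 3 ∧ (∀ k : ℕ, 2 ≤ S.s1 k ∧ S.s1 k ≤ ask1 k) ∧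
    (∀ ω : Omega, 1 ≤ S.s2 ω ∧ S.s2 ω ≤ ask2 ω)

/-- Frictionless self-financing condition for the price process `S`, from pre-trade
initial position `(x0, y0)`. -/
def SelfFinancingFL (x0 y0 : ℝ) (S : PriceProc) (φ : Strat) : Prop :=
  (φ.a0 - x0 = -(φ.b0 - y0) * S.s0) ∧
  (∀ k : ℕ, φ.a1 k - φ.a0 = -(φ.b1 k - φ.b0) * S.s1 k) ∧
  (∀ ω : Omega, φ.a2 ω - φ.a1 ω.1 = -(φ.b2 ω - φ.b1 ω.1) * S.s2 ω)

/-- Expected logarithmic utility `E[log f]`, with values in the extended reals. -/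
def elog (μ : Measure Omega) (f : Omega → ℝ) : EReal :=
  ((∫⁻ ω, ENNReal.ofReal (Real.log (f ω)) ∂μ : ℝ≥0∞) : EReal) -
    ((∫⁻ ω, ENNReal.ofReal (-Real.log (f ω)) ∂μ : ℝ≥0∞) : EReal)

/-- Admissibility for the transaction-cost problem with pre-trade initial position `(4, -1)`:
self-financing, liquidating, with strictly positive terminal wealth a.s. -/
def AdmissibleTC (n : ℕ) (φ : Strat) : Prop :=
  SelfFinancingTC 4 (-1) φ ∧ (∀ ω : Omega, φ.b2 ω = 0) ∧ (∀ᵐ ω ∂(P n), 0 < φ.a2 ω)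

/-- The value `J` of the transaction-cost utility maximization problem. -/
def JTC (n : ℕ) : EReal :=
  sSup {x : EReal | ∃ φ : Strat, AdmissibleTC n φ ∧ x = elog (P n) φ.a2}

/-- Admissibility for the frictionless problem for `S` with pre-trade initial position `(4, -1)`. -/
def AdmissibleFL (n : ℕ) (S : PriceProc) (φ : Strat) : Prop :=
  SelfFinancingFL 4 (-1) S φ ∧ (∀ ω : Omega, φ.b2 ω = 0) ∧ (∀ᵐ ω ∂(P n), 0 < φ.a2 ω)

/-- The value `J(S̃)` of the frictionless utility maximization problem for the price process `S̃`. -/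
def JFL (n : ℕ) (S : PriceProc) : EReal :=
  sSup {x : EReal | ∃ φ : Strat, AdmissibleFL n S φ ∧ x = elog (P n) φ.a2}

end

noncomputable section

/-- The conditional probability `2^{-(n+k)}` of an upward jump, as a real number. -/
def jumpProb (n k : ℕ) : ℝ := (1 / 2 : ℝ) ^ (n + k)

/-- The number of shares sold short at time 1 by the optimal strategy with transaction costs. -/
def optShort (n k : ℕ) : ℝ := (1 - jumpProb n k * (2 + k)) / (1 + k)

/-- The terminal wealth of the optimal strategy with transaction costs. -/
def optWealth (n : ℕ) : Omega → ℝ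
  | (k, true) => jumpProb n k * (2 + k)
  | (k, false) => (2 + k) * (1 - jumpProb n k) / (1 + k)

end

lemma jumpProb_pos (n k : ℕ) : 0 < jumpProb n k := by
  unfold jumpProb; positivity

lemma q_eq_ofReal (n k : ℕ) : q n k = ENNReal.ofReal (jumpProb n k) := by
  unfold q jumpProb
  rw [ENNReal.ofReal_pow (by norm_num), one_div, ENNReal.ofReal_inv_of_pos (by norm_num)]
  norm_num

lemma one_sub_q_eq_ofReal (n k : ℕ) : 1 - q n k = ENNReal.ofReal (1 - jumpProb n k) := by
  rw [q_eq_ofReal, ENNReal.ofReal_sub _ (jumpProb_pos n k).le, ENNReal.ofReal_one]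

lemma jumpProb_mul_lt_one {n : ℕ} (hn : 2 ≤ n) (k : ℕ) : jumpProb n k * (2 + k) < 1 := by
  have hnat : (2 + k : ℕ) < 2 ^ (n + k) :=
    lt_of_le_of_lt (by omega) (Nat.lt_two_pow_self (n := n + k))
  have hreal : (2 + k : ℝ) < 2 ^ (n + k) := by exact_mod_cast hnat
  unfold jumpProb
  rw [one_div, inv_pow, inv_mul_lt_one₀ (by positivity)]
  exact hreal

lemma jumpProb_lt_one {n : ℕ} (hn : 2 ≤ n) (k : ℕ) : jumpProb n k < 1 := by
  nlinarith [jumpProb_mul_lt_one hn k, jumpProb_pos n k,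
    mul_nonneg (jumpProb_pos n k).le (Nat.cast_nonneg (α := ℝ) k)]

lemma optShort_pos {n : ℕ} (hn : 2 ≤ n) (k : ℕ) : 0 < optShort n k := by
  have := jumpProb_mul_lt_one hn k
  unfold optShort
  exact div_pos (by linarith) (by positivity)

lemma optWealth_true_eq (n k : ℕ) : optWealth n (k, true) = 1 - optShort n k * (1 + k) := by
  unfold optWealth optShort
  have : (1 + k : ℝ) ≠ 0 := by positivity
  field_simp
  ring

lemma optWealth_false_eq (n k : ℕ) : optWealth n (k, false) = 1 + optShort n k := by
  unfold optWealth optShort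
  have : (1 + k : ℝ) ≠ 0 := by positivity
  field_simp
  ring

lemma optWealth_pos {n : ℕ} (hn : 2 ≤ n) : ∀ ω, 0 < optWealth n ω
  | (k, true) => mul_pos (jumpProb_pos n k) (by positivity)
  | (k, false) => by
    rw [optWealth_false_eq]
    linarith [optShort_pos hn k]

lemma optWealth_le_two {n : ℕ} (hn : 2 ≤ n) : ∀ ω, optWealth n ω ≤ 2
  | (k, true) => (jumpProb_mul_lt_one hn k).le.trans (by norm_num)
  | (k, false) => by
    unfold optWealth
    rw [div_le_iff₀ (by positivity)]
    have hk : (0 : ℝ) ≤ k := k.cast_nonneg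
    nlinarith [jumpProb_pos n k]

lemma pk_ne_zero {n : ℕ} (hn : n ≠ 0) (k : ℕ) : pk n k ≠ 0 := by
  unfold pk
  split_ifs
  · exact (tsub_pos_of_lt (pow_lt_one₀ (by simp) (by simp) hn)).ne'
  · exact pow_ne_zero _ (by simp)

lemma w_ne_zero {n : ℕ} (hn : 2 ≤ n) : ∀ ω, w n ω ≠ 0
  | (k, true) => mul_ne_zero (pk_ne_zero (by omega) k) (pow_ne_zero _ (by simp))
  | (k, false) => mul_ne_zero (pk_ne_zero (by omega) k) (by
      rw [one_sub_q_eq_ofReal, ne_eq, ENNReal.ofReal_eq_zero, not_le]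
      linarith [jumpProb_lt_one hn k])

lemma lintegral_P (n : ℕ) (f : Omega → ℝ≥0∞) :
    ∫⁻ ω, f ω ∂(P n) =
      ∑' k, pk n k * ((1 - q n k) * f (k, false) + q n k * f (k, true)) := by
  unfold P
  rw [lintegral_sum_measure, ENNReal.tsum_prod']
  refine tsum_congr fun k => ?_
  rw [tsum_bool]
  simp [lintegral_smul_measure, w, mul_add, mul_assoc]

lemma tsum_pk (n : ℕ) : ∑' k, pk n k = 1 := by
  rw [tsum_eq_zero_add' ENNReal.summable]
  have hsucc : ∀ k, pk n (k + 1) = (2 : ℝ≥0∞)⁻¹ ^ n * (2 : ℝ≥0∞)⁻¹ ^ (k + 1) := fun k => by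
    simp [pk, pow_add]
  have hzero : pk n 0 = 1 - (2 : ℝ≥0∞)⁻¹ ^ n := by simp [pk]
  simp_rw [hsucc, hzero]
  rw [ENNReal.tsum_mul_left, ENNReal.tsum_geometric_add_one, ENNReal.one_sub_inv_two, inv_inv,
    ENNReal.inv_mul_cancel (by norm_num) (by norm_num), mul_one]
  exact tsub_add_cancel_of_le (pow_le_one₀ (by simp) (by simp))

instance isProbabilityMeasure_P {n : ℕ} [hn : Fact (2 ≤ n)] : IsProbabilityMeasure (P n) where
  measure_univ := by
    have hq : ∀ k, 1 - q n k + q n k = 1 := fun k => tsub_add_cancel_of_le <| by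
      rw [q_eq_ofReal]
      exact ENNReal.ofReal_le_one.mpr (jumpProb_lt_one hn.out k).le
    rw [← lintegral_one, lintegral_P]
    simp [hq, tsum_pk]

lemma forall_of_ae_P {n : ℕ} (hn : 2 ≤ n) {p : Omega → Prop} (h : ∀ᵐ ω ∂(P n), p ω) (ω : Omega) :
    p ω := by
  unfold P at h
  rw [Measure.ae_sum_iff] at h
  have hω := h ω
  rw [Measure.ae_ennreal_smul_measure_iff (w_ne_zero hn ω), ae_dirac_eq] at hω
  exact hω

/-- A payoff satisfying the budget constraint of the dual pricing measure has expectation at most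
one relative to the optimal wealth. -/
lemma lintegral_div_optWealth_le {n : ℕ} (hn : 2 ≤ n) {u : Omega → ℝ} (hu : ∀ ω, 0 ≤ u ω)
    (hbudget : ∀ k : ℕ, (1 + k) * u (k, false) + u (k, true) ≤ 2 + k) :
    ∫⁻ ω, ENNReal.ofReal (u ω / optWealth n ω) ∂(P n) ≤ 1 := by
  rw [lintegral_P]
  refine (ENNReal.tsum_le_tsum fun k => ?_).trans_eq (tsum_pk n)
  refine mul_le_of_le_one_right' ?_
  have hq := jumpProb_pos n k
  have hq1 : 0 < 1 - jumpProb n k := by linarith [jumpProb_lt_one hn k]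
  have hf := hu (k, false)
  have ht := hu (k, true)
  have hVf := optWealth_pos hn (k, false)
  have hVt := optWealth_pos hn (k, true)
  rw [one_sub_q_eq_ofReal, q_eq_ofReal, ← ENNReal.ofReal_mul hq1.le, ← ENNReal.ofReal_mul hq.le,
    ← ENNReal.ofReal_add (by positivity) (by positivity), ENNReal.ofReal_le_one]
  have hsum : (1 - jumpProb n k) * (u (k, false) / optWealth n (k, false)) +
      jumpProb n k * (u (k, true) / optWealth n (k, true)) =
      ((1 + k) * u (k, false) + u (k, true)) / (2 + k) := by
    unfold optWealth
    field_simp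
  rw [hsum, div_le_one (by positivity)]
  exact hbudget k

lemma integrable_div_optWealth {n : ℕ} (hn : 2 ≤ n) {u : Omega → ℝ} (hu : ∀ ω, 0 ≤ u ω)
    (hbudget : ∀ k : ℕ, (1 + k) * u (k, false) + u (k, true) ≤ 2 + k) :
    Integrable (fun ω => u ω / optWealth n ω) (P n) := by
  refine (lintegral_ofReal_ne_top_iff_integrable (Measurable.of_discrete).aestronglyMeasurable
    (Eventually.of_forall fun ω => div_nonneg (hu ω) (optWealth_pos hn ω).le)).mp ?_
  exact ((lintegral_div_optWealth_le hn hu hbudget).trans_lt ENNReal.one_lt_top).ne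

lemma integral_div_optWealth_le {n : ℕ} (hn : 2 ≤ n) {u : Omega → ℝ} (hu : ∀ ω, 0 ≤ u ω)
    (hbudget : ∀ k : ℕ, (1 + k) * u (k, false) + u (k, true) ≤ 2 + k) :
    ∫ ω, u ω / optWealth n ω ∂(P n) ≤ 1 := by
  rw [integral_eq_lintegral_of_nonneg_ae
    (Eventually.of_forall fun ω => div_nonneg (hu ω) (optWealth_pos hn ω).le)
    (Measurable.of_discrete).aestronglyMeasurable]
  exact ENNReal.toReal_le_of_le_ofReal zero_le_one
    (by simpa using lintegral_div_optWealth_le hn hu hbudget)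

lemma integrable_log_optWealth {n : ℕ} (hn : 2 ≤ n) :
    Integrable (fun ω => Real.log (optWealth n ω)) (P n) := by
  have : Fact (2 ≤ n) := ⟨hn⟩
  have hinv := integrable_div_optWealth hn (u := fun _ => 1) (fun _ => zero_le_one)
    (fun k => by linarith)
  refine (hinv.add (integrable_const (1 : ℝ))).mono' (Measurable.of_discrete).aestronglyMeasurable
    (Eventually.of_forall fun ω => ?_)
  have hpos := optWealth_pos hn ω
  have hupper := Real.log_le_sub_one_of_pos hpos
  have hlower := Real.one_sub_inv_le_log_of_pos hpos
  have hinvpos : 0 < (optWealth n ω)⁻¹ := inv_pos.mpr hpos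
  simp only [Pi.add_apply, one_div, Real.norm_eq_abs]
  rw [abs_le]
  constructor <;> linarith [optWealth_le_two hn ω]

lemma coe_lintegral_sub_lintegral {μ : Measure Omega} {g : Omega → ℝ} (hg : Integrable g μ) :
    ((∫⁻ ω, ENNReal.ofReal (g ω) ∂μ : ℝ≥0∞) : EReal) -
      ((∫⁻ ω, ENNReal.ofReal (-g ω) ∂μ : ℝ≥0∞) : EReal) = ((∫ ω, g ω ∂μ : ℝ) : EReal) := by
  rw [integral_eq_lintegral_pos_part_sub_lintegral_neg_part hg, EReal.coe_sub,
    EReal.coe_ennreal_toReal hg.lintegral_lt_top.ne,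
    EReal.coe_ennreal_toReal (by simpa using hg.neg.lintegral_lt_top.ne)]

lemma elog_le_integral {μ : Measure Omega} {f g : Omega → ℝ} (hg : Integrable g μ)
    (h : ∀ ω, Real.log (f ω) ≤ g ω) : elog μ f ≤ ((∫ ω, g ω ∂μ : ℝ) : EReal) := by
  rw [← coe_lintegral_sub_lintegral hg]
  refine EReal.sub_le_sub ?_ ?_ <;> rw [EReal.coe_ennreal_le_coe_ennreal_iff] <;>
    exact lintegral_mono fun ω => ENNReal.ofReal_le_ofReal (by linarith [h ω])

lemma integral_le_elog {μ : Measure Omega} {f g : Omega → ℝ} (hg : Integrable g μ)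
    (h : ∀ ω, g ω ≤ Real.log (f ω)) : ((∫ ω, g ω ∂μ : ℝ) : EReal) ≤ elog μ f := by
  rw [← coe_lintegral_sub_lintegral hg]
  refine EReal.sub_le_sub ?_ ?_ <;> rw [EReal.coe_ennreal_le_coe_ennreal_iff] <;>
    exact lintegral_mono fun ω => ENNReal.ofReal_le_ofReal (by linarith [h ω])

/-- Trading at any price inside the spread is at least as good as trading with transaction
costs. -/
lemma neg_max_mul_add_max_mul_le {x y bid ask s : ℝ} (hbid : bid ≤ s) (hask : s ≤ ask) :
    -(max (x - y) 0) * ask + max (y - x) 0 * bid ≤ -(x - y) * s := by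
  rcases le_total x y with h | h
  · rw [max_eq_right (by linarith), max_eq_left (by linarith)]
    nlinarith
  · rw [max_eq_left (by linarith), max_eq_right (by linarith)]
    nlinarith

lemma AdmissibleTC.pos {n : ℕ} {φ : Strat} (hn : 2 ≤ n) (hφ : AdmissibleTC n φ) (ω : Omega) :
    0 < φ.a2 ω :=
  forall_of_ae_P hn hφ.2.2 ω

lemma AdmissibleTC.a0_add_le {n : ℕ} {φ : Strat} (hφ : AdmissibleTC n φ) :
    φ.a0 + 3 * φ.b0 ≤ 1 := by
  have := hφ.1.1.trans (neg_max_mul_add_max_mul_le le_rfl le_rfl)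
  linarith

lemma AdmissibleTC.a1_le {n : ℕ} {φ : Strat} (hφ : AdmissibleTC n φ) (k : ℕ) {s : ℝ}
    (hs : 2 ≤ s) (hs' : s ≤ 2 + k) : φ.a1 k + s * φ.b1 k ≤ φ.a0 + s * φ.b0 := by
  have := (hφ.1.2.1 k).trans (neg_max_mul_add_max_mul_le hs hs')
  linarith

lemma AdmissibleTC.a2_true_le {n : ℕ} {φ : Strat} (hφ : AdmissibleTC n φ) (k : ℕ) :
    φ.a2 (k, true) ≤ φ.a1 k + (3 + k) * φ.b1 k := by
  have h := (hφ.1.2.2 (k, true)).trans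
    (neg_max_mul_add_max_mul_le (s := 3 + k) (by linarith [k.cast_nonneg (α := ℝ)]) le_rfl)
  rw [hφ.2.1] at h
  linarith

lemma AdmissibleTC.a2_false_le {n : ℕ} {φ : Strat} (hφ : AdmissibleTC n φ) (k : ℕ) :
    φ.a2 (k, false) ≤ φ.a1 k + φ.b1 k := by
  have h := (hφ.1.2.2 (k, false)).trans (neg_max_mul_add_max_mul_le (s := 1) le_rfl le_rfl)
  rw [hφ.2.1] at h
  linarith

/-- Because the ask prices are unbounded, an admissible strategy cannot be short at time 0. -/
lemma AdmissibleTC.b0_nonneg {n : ℕ} {φ : Strat} (hn : 2 ≤ n) (hφ : AdmissibleTC n φ) :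
    0 ≤ φ.b0 := by
  by_contra! hneg
  obtain ⟨k, hk⟩ := exists_nat_gt (1 + 1 / (-φ.b0))
  have hk' : 1 < (k - 1) * (-φ.b0) := by
    rw [← div_lt_iff₀ (by linarith)]
    linarith
  have hk0 : (0 : ℝ) ≤ k := k.cast_nonneg
  have h0 := hφ.a0_add_le
  have h1 := hφ.a1_le k (s := 2 + k) (by linarith) le_rfl
  have ht := (hφ.pos hn (k, true)).trans_le (hφ.a2_true_le k)
  have hf := (hφ.pos hn (k, false)).trans_le (hφ.a2_false_le k)
  have : 0 < (2 + k) * (φ.a1 k + (2 + k) * φ.b1 k) := by nlinarith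
  have : 0 < φ.a1 k + (2 + k) * φ.b1 k := pos_of_mul_pos_right this (by positivity)
  linarith

lemma AdmissibleTC.budget {n : ℕ} {φ : Strat} (hn : 2 ≤ n) (hφ : AdmissibleTC n φ) (k : ℕ) :
    (1 + k) * φ.a2 (k, false) + φ.a2 (k, true) ≤ 2 + k := by
  have hk0 : (0 : ℝ) ≤ k := k.cast_nonneg
  have h0 := hφ.a0_add_le
  have hb := hφ.b0_nonneg hn
  have h1 := hφ.a1_le k (s := 2) le_rfl (by linarith)
  have hvalue : φ.a1 k + 2 * φ.b1 k ≤ 1 := by linarith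
  nlinarith [hφ.a2_true_le k, hφ.a2_false_le k]

lemma JTC_le {n : ℕ} (hn : 2 ≤ n) :
    JTC n ≤ ((∫ ω, Real.log (optWealth n ω) ∂(P n) : ℝ) : EReal) := by
  have : Fact (2 ≤ n) := ⟨hn⟩
  refine sSup_le ?_
  rintro _ ⟨φ, hφ, rfl⟩
  have hpos := fun ω => (hφ.pos hn ω).le
  have hlog := integrable_log_optWealth hn
  have hdiv := integrable_div_optWealth hn hpos (hφ.budget hn)
  have hdiv' := hdiv.sub (integrable_const (1 : ℝ))
  refine (elog_le_integral (hlog.add hdiv') fun ω => ?_).trans ?_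
  · have h := Real.log_le_sub_one_of_pos (div_pos (hφ.pos hn ω) (optWealth_pos hn ω))
    rw [Real.log_div (hφ.pos hn ω).ne' (optWealth_pos hn ω).ne'] at h
    simp only [Pi.add_apply, Pi.sub_apply]
    linarith
  · rw [EReal.coe_le_coe_iff, integral_add' hlog hdiv', integral_sub' hdiv (integrable_const _)]
    have := integral_div_optWealth_le hn hpos (hφ.budget hn)
    simp only [integral_const, probReal_univ, one_smul]
    linarith

/-- If the price at time 1 is always `2`, shorting at time 0 is an arbitrage. -/
lemma lt_JFL_of_s1_eq_two {n : ℕ} (hn : 2 ≤ n) {S : PriceProc} (hS0 : S.s0 = 3)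
    (hS1 : ∀ k, S.s1 k = 2) (c : ℝ) : (c : EReal) < JFL n S := by
  have : Fact (2 ≤ n) := ⟨hn⟩
  set N : ℝ := Real.exp (c + 1)
  have hN : 0 < N := Real.exp_pos _
  let φ : Strat := ⟨1 + 3 * N, -N, fun _ => 1 + N, fun _ => 0, fun _ => 1 + N, fun _ => 0⟩
  have hφ : AdmissibleFL n S φ := by
    refine ⟨⟨?_, fun k => ?_, fun ω => ?_⟩, fun _ => rfl, Eventually.of_forall fun _ => ?_⟩
    · simp only [φ, hS0]; ring
    · simp only [φ, hS1]; ring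
    · simp only [φ]; ring
    · simp only [φ]; positivity
  calc (c : EReal) < ((∫ _, (c + 1) ∂(P n) : ℝ) : EReal) := by
        rw [EReal.coe_lt_coe_iff]
        simp
    _ ≤ elog (P n) φ.a2 := integral_le_elog (integrable_const _) fun ω => by
        rw [Real.le_log_iff_exp_le (by simp only [φ]; positivity)]
        simp only [φ]
        linarith
    _ ≤ JFL n S := le_sSup ⟨φ, hφ, rfl⟩

/-- If the price at time 1 exceeds the bid price `2` in some state, then the optimal strategy with
transaction costs performs strictly better without frictions. -/
lemma lt_JFL_of_two_lt_s1 {n : ℕ} (hn : 2 ≤ n) {S : PriceProc} (hS : SpreadValued S) {m : ℕ}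
    (hm : 2 < S.s1 m) :
    ((∫ ω, Real.log (optWealth n ω) ∂(P n) : ℝ) : EReal) < JFL n S := by
  have : Fact (2 ≤ n) := ⟨hn⟩
  let φ : Strat := ⟨1, 0, fun k => 1 + optShort n k * S.s1 k, fun k => -optShort n k,
    fun ω => 1 + optShort n ω.1 * (S.s1 ω.1 - S.s2 ω), fun _ => 0⟩
  have hbid : ∀ ω, optWealth n ω + optShort n ω.1 * (S.s1 ω.1 - 2) ≤ φ.a2 ω := by
    rintro ⟨k, _ | _⟩
    · have h2 : S.s2 (k, false) ≤ 1 := (hS.2.2 (k, false)).2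
      rw [optWealth_false_eq]
      simp only [φ]
      nlinarith [optShort_pos hn k]
    · have h2 : S.s2 (k, true) ≤ 3 + k := (hS.2.2 (k, true)).2
      rw [optWealth_true_eq]
      simp only [φ]
      nlinarith [optShort_pos hn k]
  have hle : ∀ ω, optWealth n ω ≤ φ.a2 ω := fun ω => by
    nlinarith [hbid ω, mul_nonneg (optShort_pos hn ω.1).le (sub_nonneg.mpr (hS.2.1 ω.1).1)]
  have hlt : optWealth n (m, false) < φ.a2 (m, false) := by
    have := hbid (m, false)
    nlinarith [mul_pos (optShort_pos hn m) (sub_pos.mpr hm)]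
  have hφ : AdmissibleFL n S φ := by
    refine ⟨⟨?_, fun k => ?_, fun ω => ?_⟩, fun _ => rfl,
      Eventually.of_forall fun ω => (optWealth_pos hn ω).trans_le (hle ω)⟩
    · simp only [φ, hS.1]; ring
    · simp only [φ]; ring
    · simp only [φ]; ring
  set δ : ℝ := Real.log (φ.a2 (m, false)) - Real.log (optWealth n (m, false))
  have hδ : 0 < δ := sub_pos.mpr (Real.log_lt_log (optWealth_pos hn _) hlt)
  have hlog := integrable_log_optWealth hn
  have hind : Integrable (Set.indicator {((m, false) : Omega)} fun _ => δ) (P n) :=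
    (integrable_const δ).indicator (measurableSet_singleton _)
  have hmass : 0 < (P n).real {((m, false) : Omega)} := by
    refine ENNReal.toReal_pos (fun h => ?_) (measure_ne_top _ _)
    exact forall_of_ae_P hn (measure_eq_zero_iff_ae_notMem.mp h) (m, false) rfl
  calc ((∫ ω, Real.log (optWealth n ω) ∂(P n) : ℝ) : EReal)
      < ((∫ ω, ((fun ω => Real.log (optWealth n ω)) +
          Set.indicator {((m, false) : Omega)} fun _ => δ) ω ∂(P n) : ℝ) : EReal) := by
        rw [EReal.coe_lt_coe_iff, integral_add' hlog hind,
          integral_indicator_const _ (measurableSet_singleton _), smul_eq_mul]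
        linarith [mul_pos hmass hδ]
    _ ≤ elog (P n) φ.a2 := integral_le_elog (hlog.add hind) fun ω => by
        by_cases hω : ω = (m, false)
        · subst hω
          simp [δ]
        · simpa [hω] using Real.log_le_log (optWealth_pos hn ω) (hle ω)
    _ ≤ JFL n S := le_sSup ⟨φ, hφ, rfl⟩

/-- for all sufficiently large `n`, every spread-valued adapted process `S̃`
satisfies `J(S̃) > J` (and `J < ∞`); in particular no spread-valued adapted process is a
shadow price, i.e. there is no such `S̃` with `J(S̃) = J`. -/
theorem stmt_0 :
    ∃ n₀ : ℕ, ∀ n : ℕ, n₀ ≤ n →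
      ((∀ S : PriceProc, SpreadValued S → JTC n < JFL n S) ∧ JTC n < ⊤) ∧
      ¬ ∃ S : PriceProc, SpreadValued S ∧ JFL n S = JTC n := by
  refine ⟨2, fun n hn => ?_⟩
  have hlt : ∀ S : PriceProc, SpreadValued S → JTC n < JFL n S := fun S hS => by
    refine (JTC_le hn).trans_lt ?_
    by_cases h : ∀ k, S.s1 k = 2
    · exact lt_JFL_of_s1_eq_two hn hS.1 h _
    · push Not at h
      obtain ⟨m, hm⟩ := h
      exact lt_JFL_of_two_lt_s1 hn hS (lt_of_le_of_ne (hS.2.1 m).1 hm.symm)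
  refine ⟨⟨hlt, (JTC_le hn).trans_lt (EReal.coe_lt_top _)⟩, ?_⟩
  rintro ⟨S, hS, hJ⟩
  exact (hlt S hS).ne' hJ
end

section
/- In the counterexample market with parameter n ≥ 1: for every adapted process S̃ = (S̃_t)_{t=0,1,2} with S̃_0 = 3 a.s. and S̃_1 = 2 a.s., the frictionless value is J(S̃) = +∞; indeed, for every m ∈ ℕ there is a liquidating frictionless self-financing strategy for S̃ (shorting m extra shares at time 0 and covering the whole short position at time 1) whose terminal payoff satisfies φ⁰_2 = 2 + m a.s., so that sup E[log φ⁰_2] = ∞. In particular, the frictionless market given by S̃ admits arbitrage. -/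
open MeasureTheory ENNReal Filter

/-- The strategy that, from the pre-trade position `(x, y)`, shorts `m` extra shares at price `3`
at time 0 and closes the whole risky position at price `2` at time 1. -/
def shortAndCover (x y m : ℝ) : Strat where
  a0 := x + 3 * m
  b0 := y - m
  a1 := fun _ => x + 2 * y + m
  b1 := fun _ => 0
  a2 := fun _ => x + 2 * y + m
  b2 := fun _ => 0

lemma selfFinancingFL_shortAndCover (x y m : ℝ) {S : PriceProc}
    (h0 : S.s0 = 3) (h1 : ∀ k : ℕ, S.s1 k = 2) :
    SelfFinancingFL x y S (shortAndCover x y m) := by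
  refine ⟨?_, fun k => ?_, fun ω => ?_⟩
  · simp only [shortAndCover, h0]
    ring
  · simp only [shortAndCover, h1]
    ring
  · simp [shortAndCover]

lemma elog_const (μ : Measure Omega) {c : ℝ} (hc : 1 ≤ c) :
    elog μ (fun _ => c) = ((ENNReal.ofReal (Real.log c) * μ Set.univ : ℝ≥0∞) : EReal) := by
  have h : ENNReal.ofReal (-Real.log c) = 0 :=
    ENNReal.ofReal_of_nonpos (neg_nonpos.2 (Real.log_nonneg hc))
  simp only [elog, lintegral_const, h, zero_mul, EReal.coe_ennreal_zero, sub_zero]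

lemma w_le_P_univ (n : ℕ) (ω : Omega) : w n ω ≤ P n Set.univ := by
  rw [P, Measure.sum_apply _ MeasurableSet.univ]
  refine le_trans ?_ (ENNReal.le_tsum ω)
  simp

lemma P_univ_ne_zero {n : ℕ} (hn : 1 ≤ n) : P n Set.univ ≠ 0 := by
  have hlt : (2 : ℝ≥0∞)⁻¹ ^ n < 1 :=
    pow_lt_one₀ zero_le ENNReal.one_half_lt_one (by omega)
  have hw : 0 < w n (0, false) := by
    simp only [w, pk, q, add_zero, if_true]
    exact ENNReal.mul_pos (tsub_pos_of_lt hlt).ne' (tsub_pos_of_lt hlt).ne'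
  exact (hw.trans_le (w_le_P_univ n _)).ne'

open scoped Topology in
lemma tendsto_elog_const {μ : Measure Omega} (hμ : μ Set.univ ≠ 0) :
    Tendsto (fun m : ℕ => elog μ (fun _ => 2 + (m : ℝ))) atTop (𝓝 ⊤) := by
  have hlog : Tendsto (fun m : ℕ => ENNReal.ofReal (Real.log (2 + (m : ℝ)))) atTop (𝓝 ⊤) :=
    ENNReal.tendsto_ofReal_atTop.comp (Real.tendsto_log_atTop.comp
      (tendsto_atTop_add_const_left _ _ tendsto_natCast_atTop_atTop))
  have hmul := ENNReal.Tendsto.mul_const (b := μ Set.univ) hlog (Or.inl ENNReal.top_ne_zero)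
  rw [ENNReal.top_mul hμ] at hmul
  refine ((continuous_coe_ennreal_ereal.tendsto _).comp hmul).congr fun m => ?_
  have hm : (0 : ℝ) ≤ m := m.cast_nonneg
  exact (elog_const μ (by linarith)).symm


/-- for every adapted process `S̃` with `S̃_0 = 3` and `S̃_1 = 2`, the
frictionless value is `J(S̃) = +∞`: for every `m` there is a liquidating frictionless
self-financing strategy (shorting `m` extra shares at time 0 and covering at time 1)
with terminal payoff `φ⁰_2 = 2 + m` a.s., so `sup E[log φ⁰_2] = ∞`; in particular the
frictionless market given by `S̃` admits arbitrage. -/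
theorem stmt_3 (n : ℕ) (hn : 1 ≤ n) (S : PriceProc)
    (h0 : S.s0 = 3) (h1 : ∀ k : ℕ, S.s1 k = 2) :
    (∀ m : ℕ, ∃ φ : Strat, SelfFinancingFL 4 (-1) S φ ∧ (∀ ω : Omega, φ.b2 ω = 0) ∧
      ∀ ω : Omega, φ.a2 ω = 2 + m) ∧
    JFL n S = ⊤ ∧
    (∃ φ : Strat, SelfFinancingFL 0 0 S φ ∧ (∀ ω : Omega, φ.b2 ω = 0) ∧
      (∀ ω : Omega, 0 ≤ φ.a2 ω) ∧ ∃ ω : Omega, 0 < φ.a2 ω) := by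
  have hpay (m : ℕ) : (shortAndCover 4 (-1) m).a2 = fun _ => 2 + (m : ℝ) := by
    funext ω
    simp only [shortAndCover]
    ring
  refine ⟨fun m => ⟨shortAndCover 4 (-1) m, selfFinancingFL_shortAndCover _ _ _ h0 h1,
    fun _ => rfl, fun ω => congrFun (hpay m) ω⟩, ?_, ?_⟩
  · refine top_le_iff.1 (le_of_tendsto' (tendsto_elog_const (P_univ_ne_zero hn)) fun m => ?_)
    refine le_sSup ⟨shortAndCover 4 (-1) m,
      ⟨selfFinancingFL_shortAndCover _ _ _ h0 h1, fun _ => rfl, ?_⟩, by rw [hpay]⟩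
    rw [hpay]
    exact Eventually.of_forall fun _ => by positivity
  · exact ⟨shortAndCover 0 0 1, selfFinancingFL_shortAndCover _ _ _ h0 h1, fun _ => rfl,
      fun _ => by simp [shortAndCover], (0, true), by simp [shortAndCover]⟩
end

section
/- Let Π = (π^{ij})_{1≤i,j≤d} be a bid-ask matrix with solvency cone K(Π). If w ∈ K(Π)* and w ≠ 0, then all components of w are strictly positive: w_i > 0 for every i = 1, …, d. -/
/-- Membership in the solvency cone `K(Π)` associated with a bid-ask matrix
`Π = (π^{ij})`: the convex cone of all nonnegative linear combinations of the canonical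
basis vectors `e_i` and the vectors `π^{ij} e_i - e_j`. -/
def memSolvencyCone (d : ℕ) (π : Fin d → Fin d → ℝ) (v : Fin d → ℝ) : Prop :=
  ∃ (c : Fin d → ℝ) (a : Fin d → Fin d → ℝ),
    (∀ i, 0 ≤ c i) ∧ (∀ i j, 0 ≤ a i j) ∧
    v = (∑ i, c i • (Pi.single i 1 : Fin d → ℝ)) +
        ∑ i, ∑ j,
          a i j • (π i j • (Pi.single i 1 : Fin d → ℝ) - (Pi.single j 1 : Fin d → ℝ))

/-- A bid-ask matrix: positive entries, unit diagonal, and direct exchanges are not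
dominated by successive trades. -/
def IsBidAskMatrix (d : ℕ) (π : Fin d → Fin d → ℝ) : Prop :=
  (∀ i j, 0 < π i j) ∧ (∀ i, π i i = 1) ∧ (∀ i j k, π i j ≤ π i k * π k j)

theorem memSolvencyCone_single (d : ℕ) (π : Fin d → Fin d → ℝ) (i : Fin d) :
    memSolvencyCone d π (Pi.single i 1) := by
  refine ⟨Pi.single i 1, 0, fun k => ?_, fun _ _ => le_rfl, ?_⟩
  · by_cases h : k = i <;> simp [h]
  · simp [Pi.single_apply i, ite_smul]

theorem memSolvencyCone_exchange (d : ℕ) (π : Fin d → Fin d → ℝ) (i j : Fin d) :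
    memSolvencyCone d π (π i j • (Pi.single i 1 : Fin d → ℝ) - Pi.single j 1) := by
  refine ⟨0, fun k l => if k = i then if l = j then 1 else 0 else 0,
    fun _ => le_rfl, fun k l => ?_, ?_⟩
  · dsimp only
    split_ifs <;> norm_num
  · simp only [Pi.zero_apply, zero_smul, Finset.sum_const_zero, zero_add]
    rw [Finset.sum_eq_single i, Finset.sum_eq_single j]
    · simp
    · intro l _ hl
      simp [hl]
    · simp
    · intro k _ hk
      simp [hk]
    · simp

/-- any nonzero element of the polar of the solvency cone `K(Π)` has all
components strictly positive. -/
theorem stmt_9 (d : ℕ) (π : Fin d → Fin d → ℝ) (hπ : IsBidAskMatrix d π)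
    (w : Fin d → ℝ)
    (hw : ∀ v : Fin d → ℝ, memSolvencyCone d π v → 0 ≤ ∑ i, v i * w i)
    (hw0 : w ≠ 0) :
    ∀ i, 0 < w i := by
  have hnonneg : ∀ i, 0 ≤ w i := fun i => by
    simpa [Pi.single_apply] using hw _ (memSolvencyCone_single d π i)
  have hle : ∀ i j, w j ≤ π i j * w i := fun i j => by
    simpa [Pi.single_apply, sub_mul, Finset.sum_sub_distrib] using
      hw _ (memSolvencyCone_exchange d π i j)
  intro i
  obtain ⟨j, hj⟩ := Function.ne_iff.mp hw0
  have hwj : 0 < w j := lt_of_le_of_ne (hnonneg j) (Ne.symm hj)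
  exact pos_of_mul_pos_right (hwj.trans_le (hle i j)) (hπ.1 i j).le
end

section
/- Let U : (0,∞) → ℝ be a utility function (strictly concave, strictly increasing, differentiable) with the Inada conditions, I := (U′)^{-1}, and let Y be a random variable with Y > 0 a.s. Set Ŵ := I(Y) and suppose E[Y·Ŵ] < ∞ and E[U(Ŵ)] is well defined (e.g. E[|U(Ŵ)|] < ∞). Then for every random variable W with W > 0 a.s., E[Y·W] ≤ E[Y·Ŵ], and E[U(W)] well defined, one has E[U(W)] ≤ E[U(Ŵ)]. (The static budget-constrained utility maximization problem sup{ E[U(W)] : W > 0, E[Y W] ≤ E[Y Ŵ] } is solved by Ŵ = I(Y).) -/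
open Filter Set MeasureTheory

/-- A concave function of a real variable lies below each of its tangent lines. -/
theorem ConcaveOn.le_add_mul_sub_of_hasDerivAt {s : Set ℝ} {f : ℝ → ℝ} {f' x y : ℝ}
    (hf : ConcaveOn ℝ s f) (hx : x ∈ s) (hy : y ∈ s) (hderiv : HasDerivAt f f' x) :
    f y ≤ f x + f' * (y - x) := by
  rcases lt_trichotomy x y with h | rfl | h
  · have := hf.slope_le_of_hasDerivAt hx hy h hderiv
    rw [slope_def_field, div_le_iff₀ (sub_pos.2 h)] at this
    linarith
  · simp
  · have := hf.le_slope_of_hasDerivAt hy hx h hderiv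
    rw [slope_def_field, le_div_iff₀ (sub_pos.2 h)] at this
    linarith

/-- let `U` be a utility function with the Inada conditions and `Y > 0` a.s.
a random variable. Set `Ŵ := I(Y)` (i.e. `U'(Ŵ) = Y` a.s., `Ŵ > 0` a.s.) and suppose
`E[Y·Ŵ] < ∞` and `E[U(Ŵ)]` is well defined. Then for every random variable `W > 0` a.s.
with `E[Y·W] ≤ E[Y·Ŵ]` and `E[U(W)]` well defined, one has `E[U(W)] ≤ E[U(Ŵ)]`: the static
budget-constrained utility maximization problem is solved by `Ŵ = I(Y)`. -/
theorem stmt_12 {Ω : Type*} {m : MeasurableSpace Ω} (μ : Measure Ω) [IsProbabilityMeasure μ]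
    (U U' : ℝ → ℝ)
    (hconc : StrictConcaveOn ℝ (Ioi 0) U)
    (hmono : StrictMonoOn U (Ioi 0))
    (hderiv : ∀ x ∈ Ioi (0 : ℝ), HasDerivAt U (U' x) x)
    (hInada0 : Tendsto U' (nhdsWithin 0 (Ioi 0)) atTop)
    (hInadaInf : Tendsto U' atTop (nhds 0))
    (Y What : Ω → ℝ)
    (hY : ∀ᵐ ω ∂μ, 0 < Y ω)
    (hWhat : ∀ᵐ ω ∂μ, 0 < What ω ∧ U' (What ω) = Y ω)
    (hint1 : Integrable (fun ω => Y ω * What ω) μ)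
    (hint2 : Integrable (fun ω => U (What ω)) μ) :
    ∀ W : Ω → ℝ, (∀ᵐ ω ∂μ, 0 < W ω) →
      Integrable (fun ω => Y ω * W ω) μ →
      (∫ ω, Y ω * W ω ∂μ) ≤ (∫ ω, Y ω * What ω ∂μ) →
      Integrable (fun ω => U (W ω)) μ →
      (∫ ω, U (W ω) ∂μ) ≤ ∫ ω, U (What ω) ∂μ := by
  intro W hW hYW hbudget hUW
  have hsub : Integrable (fun ω => Y ω * W ω - Y ω * What ω) μ := hYW.sub hint1
  have key : ∫ ω, U (W ω) ∂μ ≤ ∫ ω, (U (What ω) + (Y ω * W ω - Y ω * What ω)) ∂μ := by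
    refine integral_mono_ae hUW (hint2.add hsub) ?_
    filter_upwards [hW, hWhat] with ω hw hwhat
    have := hconc.concaveOn.le_add_mul_sub_of_hasDerivAt hwhat.1 hw (hderiv _ hwhat.1)
    rwa [hwhat.2, mul_sub] at this
  rw [integral_add hint2 hsub, integral_sub hYW hint1] at key
  linarith
end

section
/- Let U : (0,∞) → ℝ be concave, nondecreasing and differentiable, and let f be a random variable with f > 0 a.s. such that E[|U(λ f)|] < ∞ for all λ in some neighborhood of 1. If a ∈ ℝ satisfies a·(λ − 1) ≥ E[U(λ f)] − E[U(f)] for every λ > 0, then E[U′(f)·f] < ∞ and a = E[U′(f)·f]. (The superdifferential inequality along the ray λ ↦ λf pins down the value a = E[U′(f)f], via monotone and dominated convergence of the difference quotients (U(λf) − U(f))/(λ − 1) → U′(f)f as λ → 1.) -/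
open Filter Set MeasureTheory

/-- for `U : (0,∞) → ℝ` concave, nondecreasing and differentiable and a random
variable `f > 0` a.s. with `E[|U(λf)|] < ∞` for all `λ` in a neighborhood of `1`, if `a ∈ ℝ`
satisfies the superdifferential inequality `a·(λ - 1) ≥ E[U(λf)] - E[U(f)]` along the ray
`λ ↦ λf` (for every `λ > 0` for which `E[U(λf)]` is defined), then `E[U'(f)·f] < ∞` and
`a = E[U'(f)·f]`. -/
theorem stmt_14 {Ω : Type*} {m : MeasurableSpace Ω} (μ : Measure Ω) [IsProbabilityMeasure μ]
    (U U' : ℝ → ℝ)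
    (hconc : ConcaveOn ℝ (Ioi 0) U)
    (hmono : MonotoneOn U (Ioi 0))
    (hderiv : ∀ x ∈ Ioi (0 : ℝ), HasDerivAt U (U' x) x)
    (f : Ω → ℝ) (hf : Measurable f) (hfpos : ∀ᵐ ω ∂μ, 0 < f ω)
    (hnbhd : ∀ᶠ l in nhds (1 : ℝ), Integrable (fun ω => U (l * f ω)) μ)
    (a : ℝ)
    (hsuper : ∀ l : ℝ, 0 < l → Integrable (fun ω => U (l * f ω)) μ →
      (∫ ω, U (l * f ω) ∂μ) - (∫ ω, U (f ω) ∂μ) ≤ a * (l - 1)) :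
    Integrable (fun ω => U' (f ω) * f ω) μ ∧ a = ∫ ω, U' (f ω) * f ω ∂μ := by
  have hU'_nonneg : ∀ y, 0 < y → 0 ≤ U' y := fun y hy => by
    have h := hconc.slope_le_of_hasDerivAt hy (mem_Ioi.2 (by linarith : (0 : ℝ) < y + 1))
      (by linarith) (hderiv y hy)
    have h' := hmono hy (mem_Ioi.2 (by linarith : (0 : ℝ) < y + 1)) (by linarith)
    rw [slope_def_field] at h
    norm_num at h
    linarith
  obtain ⟨δ, hδ, hint⟩ := Metric.eventually_nhds_iff.1 hnbhd
  set r : ℝ := min δ 1 / 4 with hr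
  have hr0 : 0 < r := by positivity
  have hrδ : 4 * r ≤ δ := by rw [hr]; linarith [min_le_left δ 1]
  have hr1 : 4 * r ≤ 1 := by rw [hr]; linarith [min_le_right δ 1]
  have hlo : Integrable (fun ω => U ((1 - 2 * r) * f ω)) μ :=
    hint (by rw [Real.dist_eq, abs_lt]; constructor <;> linarith)
  have hhi : Integrable (fun ω => U ((1 + r) * f ω)) μ :=
    hint (by rw [Real.dist_eq, abs_lt]; constructor <;> linarith)
  have hone : Integrable (fun ω => U (1 * f ω)) μ := hint (by simpa using hδ)
  have hmeas : AEStronglyMeasurable (fun ω => U' (1 * f ω) * f ω) μ := by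
    refine (((measurable_deriv U).comp hf).mul hf).aestronglyMeasurable.congr ?_
    filter_upwards [hfpos] with ω hω
    simp [(hderiv _ hω).deriv]
  have hbound : ∀ᵐ ω ∂μ, ∀ x ∈ Metric.ball (1 : ℝ) r, ‖U' (x * f ω) * f ω‖ ≤
      (U ((1 + r) * f ω) - U ((1 - 2 * r) * f ω)) / r := by
    filter_upwards [hfpos] with ω hω x hx
    rw [Metric.mem_ball, Real.dist_eq, abs_lt] at hx
    have hl : 0 < (1 - 2 * r) * f ω := mul_pos (by linarith) hω
    have hx0 : 0 < x * f ω := mul_pos (by linarith) hω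
    have hlx : (1 - 2 * r) * f ω < x * f ω := mul_lt_mul_of_pos_right (by linarith) hω
    have hxh : x * f ω ≤ (1 + r) * f ω := mul_le_mul_of_nonneg_right (by linarith) hω.le
    have hU := hmono hx0 (hx0.trans_le hxh) hxh
    have hd := hU'_nonneg _ hx0
    have hs := hconc.le_slope_of_hasDerivAt hl hx0 hlx (hderiv _ hx0)
    rw [slope_def_field, le_div_iff₀ (by linarith)] at hs
    rw [Real.norm_of_nonneg (by positivity), le_div_iff₀ hr0]
    have hsmall : U' (x * f ω) * f ω * r ≤ U' (x * f ω) * f ω * (x - (1 - 2 * r)) :=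
      mul_le_mul_of_nonneg_left (by linarith) (by positivity)
    linarith
  obtain ⟨hI, hD⟩ := hasDerivAt_integral_of_dominated_loc_of_deriv_le
    (F := fun l ω => U (l * f ω)) (F' := fun l ω => U' (l * f ω) * f ω)
    (Metric.ball_mem_nhds 1 hr0) (hnbhd.mono fun _ h => h.aestronglyMeasurable) hone hmeas
    hbound ((hhi.sub hlo).div_const r) (by
      filter_upwards [hfpos] with ω hω x hx
      rw [Metric.mem_ball, Real.dist_eq, abs_lt] at hx
      exact (hderiv _ (mul_pos (by linarith) hω)).comp x (hasDerivAt_mul_const (f ω)))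
  have hmax : IsLocalMax (fun l : ℝ => (∫ ω, U (l * f ω) ∂μ) - l * a) 1 := by
    filter_upwards [hnbhd, lt_mem_nhds (zero_lt_one' ℝ)] with l hl hl0
    have h := hsuper l hl0 hl
    simp only [one_mul]
    linarith
  have hzero := hmax.hasDerivAt_eq_zero (hD.sub (hasDerivAt_mul_const a))
  simp only [one_mul] at hI hzero
  exact ⟨hI, by linarith⟩
end

section
/- Let U : (0,∞) → ℝ be concave, nondecreasing and differentiable with lim_{x↓0} U′(x) = ∞, and extend U to [0,∞) by U(0) := lim_{x↓0} U(x), assumed finite. Let f be a nonnegative random variable. If there exists h < ∞ with E[(U(f+ε) − U(f))/ε] ≤ h for all ε ∈ (0,1], then f > 0 a.s. (If P(f = 0) > 0, the expected difference quotients explode as ε ↓ 0 by the Inada condition at 0.) -/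
open Filter Set MeasureTheory ENNReal

/-- If the derivative of `U` tends to `∞` at `a` from the right and `U` is right-continuous at `a`,
then so does the slope of `U` at `a`. -/
theorem tendsto_slope_atTop_of_tendsto_hasDerivAt {U U' : ℝ → ℝ} {a : ℝ}
    (hderiv : ∀ x ∈ Ioi a, HasDerivAt U (U' x) x)
    (hU' : Tendsto U' (nhdsWithin a (Ioi a)) atTop)
    (hU : Tendsto U (nhdsWithin a (Ioi a)) (nhds (U a))) :
    Tendsto (slope U a) (nhdsWithin a (Ioi a)) atTop := by
  refine tendsto_atTop.2 fun M => ?_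
  obtain ⟨b, hab, hb⟩ := mem_nhdsGT_iff_exists_Ioo_subset.1 (tendsto_atTop.1 hU' M)
  filter_upwards [Ioo_mem_nhdsGT hab] with x hx
  have hcont : ContinuousOn U (Icc a x) := fun y hy => by
    rcases hy.1.eq_or_lt with rfl | hay
    · exact (continuousWithinAt_Ioi_iff_Ici.1 hU).mono Icc_subset_Ici_self
    · exact (hderiv y hay).continuousAt.continuousWithinAt
  obtain ⟨c, hc, hcx⟩ :=
    exists_hasDerivAt_eq_slope U U' hx.1 hcont fun y hy => hderiv y hy.1
  rw [slope_def_field, ← hcx]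
  exact hb ⟨hc.1, hc.2.trans hx.2⟩

/-- let `U : (0,∞) → ℝ` be concave, nondecreasing and differentiable with the
Inada condition `U'(x) → ∞` as `x ↓ 0`, extended to `0` by its (finite) right limit
`U(0) = lim_{x↓0} U(x)`, and let `f ≥ 0` be a random variable. If the expected difference
quotients `E[(U(f+ε) - U(f))/ε]` stay bounded by some `h < ∞` for `ε ∈ (0,1]`, then
`f > 0` a.s: if `P(f = 0) > 0` they would explode as `ε ↓ 0`. -/
theorem stmt_15 {Ω : Type*} {m : MeasurableSpace Ω} (μ : Measure Ω) [IsProbabilityMeasure μ]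
    (U U' : ℝ → ℝ)
    (hconc : ConcaveOn ℝ (Ioi 0) U)
    (hmono : MonotoneOn U (Ioi 0))
    (hderiv : ∀ x ∈ Ioi (0 : ℝ), HasDerivAt U (U' x) x)
    (hInada0 : Tendsto U' (nhdsWithin 0 (Ioi 0)) atTop)
    (hU0 : Tendsto U (nhdsWithin 0 (Ioi 0)) (nhds (U 0)))
    (f : Ω → ℝ) (hf : Measurable f) (hfnonneg : ∀ᵐ ω ∂μ, 0 ≤ f ω)
    (h : ℝ)
    (hbdd : ∀ ε ∈ Ioc (0 : ℝ) 1,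
      (∫⁻ ω, ENNReal.ofReal ((U (f ω + ε) - U (f ω)) / ε) ∂μ) ≤ ENNReal.ofReal h) :
    ∀ᵐ ω ∂μ, 0 < f ω := by
  have hnull : μ {ω | f ω = 0} = 0 := by
    by_contra hpos
    set p := μ.real {ω | f ω = 0} with hp
    have hp0 : 0 < p := ENNReal.toReal_pos hpos (measure_ne_top _ _)
    have hslope := tendsto_slope_atTop_of_tendsto_hasDerivAt hderiv hInada0 hU0
    obtain ⟨ε, hε, hlarge⟩ := (Eventually.and (Ioc_mem_nhdsGT (zero_lt_one' ℝ))
      (tendsto_atTop.1 hslope ((max h 0 + 1) / p))).exists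
    have hle : ENNReal.ofReal (slope U 0 ε) * μ {ω | f ω = 0} ≤ ENNReal.ofReal h := by
      rw [← setLIntegral_const]
      refine le_trans ?_ (hbdd ε hε)
      refine le_trans (le_of_eq ?_) (setLIntegral_le_lintegral {ω | f ω = 0} _)
      refine setLIntegral_congr_fun (hf (measurableSet_singleton 0)) fun ω hω => ?_
      have hω : f ω = 0 := hω
      simp [slope_def_field, hω]
    rw [← ofReal_measureReal, ← hp, ← ENNReal.ofReal_mul' hp0.le] at hle
    have hle' : slope U 0 ε * p ≤ max h 0 :=
      (ENNReal.ofReal_le_ofReal_iff (le_max_right h 0)).1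
        (hle.trans (ENNReal.ofReal_le_ofReal (le_max_left h 0)))
    have := (div_le_iff₀ hp0).1 hlarge
    linarith
  have hne : ∀ᵐ ω ∂μ, f ω ≠ 0 := by simpa [ae_iff] using hnull
  filter_upwards [hfnonneg, hne] with ω h₁ h₂
  exact h₁.lt_of_ne' h₂
end
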